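/- Let G be a finite group, let M be a G-module, and define the contravariant functor (−)^∨ := Hom_ℤ(−, M) on G-modules. If (X, Y) is an r-encoding pair, then (Y^∨, X^∨) is an r-encoding pair. -/

import Mathlib

/-!
This file sets up Tate cohomology of a finite group `G` (with coefficients in objects of
`Rep ℤ G`), realized concretely in each degree `n ∈ ℤ` as
`Ĥ^n(G, M) = Ĥ⁰(G, Hom_ℤ(J n, M))`, where `J n` is the standard `n`-th syzygy of the
trivial module `ℤ` (the `n`-th tensor power of the augmentation ideal `I_G` for `n ≥ 0`,
and of its `ℤ`-linear dual for `n < 0`), and `Ĥ⁰` denotes invariants modulo norms.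
Cup products are induced by the canonical comparison maps `J (i+j) ⟶ J i ⊗ J j`.
-/

open CategoryTheory MonoidalCategory TensorProduct

set_option linter.unusedSectionVars false
set_option maxHeartbeats 1000000

attribute [instance 0] AddCommGroup.toIntModule

namespace Enc

instance smulCommClass_int (V : Type*) [AddCommMonoid V] [inst : Module ℤ V] :
    @SMulCommClass ℤ ℤ V inst.toDistribMulAction.toMulAction.toSMul
      inst.toDistribMulAction.toMulAction.toSMul :=
  @smulCommClass_self ℤ V _ inst.toDistribMulAction.toMulAction

variable {k : Type} [CommRing k] {G : Type} [Group G] [Fintype G]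

/-! ### Degree-zero Tate cohomology: invariants modulo norms -/

section Aux
variable {V V₂ : Type} [AddCommGroup V] [Module k V] [AddCommGroup V₂] [Module k V₂]

/-- The norm map `v ↦ ∑_{g ∈ G} g • v` of a representation. -/
noncomputable def rnorm (ρ : Representation k G V) : V →ₗ[k] V := ∑ g : G, ρ g

lemma rnorm_apply (ρ : Representation k G V) (v : V) : rnorm ρ v = ∑ g : G, ρ g v := by
  simp [rnorm, LinearMap.sum_apply]

lemma rnorm_mem_invariants (ρ : Representation k G V) (v : V) :
    rnorm ρ v ∈ ρ.invariants := by
  intro g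
  show (ρ g) ((∑ h : G, ρ h) v) = _
  simp only [LinearMap.sum_apply, map_sum]
  rw [Fintype.sum_equiv (Equiv.mulLeft g) _ (fun h => ρ h v) (fun h => by
    rw [← Module.End.mul_apply, ← map_mul]; rfl)]
  simp [rnorm]

/-- The norm map, viewed as landing in the invariants. -/
noncomputable def rnormRes (ρ : Representation k G V) : V →ₗ[k] ρ.invariants :=
  (rnorm ρ).codRestrict ρ.invariants (rnorm_mem_invariants ρ)

/-- The image of the norm map, inside the invariants. -/
noncomputable def rnormIm (ρ : Representation k G V) : Submodule k ρ.invariants :=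
  LinearMap.range (rnormRes ρ)

/-- Degree-zero Tate cohomology of a representation: invariants modulo norms. -/
noncomputable def tate0 (ρ : Representation k G V) : Type :=
  ρ.invariants ⧸ rnormIm ρ

noncomputable instance (ρ : Representation k G V) : AddCommGroup (tate0 ρ) :=
  inferInstanceAs (AddCommGroup (ρ.invariants ⧸ rnormIm ρ))

noncomputable instance (ρ : Representation k G V) : Module k (tate0 ρ) :=
  inferInstanceAs (Module k (ρ.invariants ⧸ rnormIm ρ))

/-- The Tate class of an invariant vector. -/
noncomputable def tate0mk {ρ : Representation k G V} (v : V) (hv : v ∈ ρ.invariants) :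
    tate0 ρ := Submodule.Quotient.mk (⟨v, hv⟩ : ρ.invariants)

lemma invariants_comp {ρ : Representation k G V} {σ : Representation k G V₂}
    (f : V →ₗ[k] V₂) (hf : ∀ (g : G) (v : V), f (ρ g v) = σ g (f v)) :
    ∀ x ∈ ρ.invariants, f x ∈ σ.invariants := by
  intro x hx g
  rw [← hf g x, hx g]

/-- Functoriality of degree-zero Tate cohomology along equivariant maps. -/
noncomputable def tate0map {ρ : Representation k G V} {σ : Representation k G V₂}
    (f : V →ₗ[k] V₂) (hf : ∀ (g : G) (v : V), f (ρ g v) = σ g (f v)) :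
    tate0 ρ →ₗ[k] tate0 σ :=
  Submodule.mapQ (rnormIm ρ) (rnormIm σ) (f.restrict (invariants_comp f hf))
    (by
      rintro ⟨x, hx⟩ ⟨y, hy⟩
      refine ⟨f y, ?_⟩
      apply Subtype.ext
      have hy' := congrArg Subtype.val hy
      show rnorm σ (f y) = _
      simp only [LinearMap.restrict_apply]
      have : rnorm σ (f y) = f (rnorm ρ y) := by
        simp only [rnorm, LinearMap.sum_apply, map_sum]
        exact Finset.sum_congr rfl fun g _ => (hf g y).symm
      rw [this]
      exact congrArg f hy')

end Aux

/-- Degree-zero Tate cohomology `Ĥ⁰(G, W) = W^G / N_G W` of an object of `Rep k G`. -/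
noncomputable def H0T (W : Rep k G) : Type := tate0 W.ρ

noncomputable instance (W : Rep k G) : AddCommGroup (H0T W) :=
  inferInstanceAs (AddCommGroup (tate0 W.ρ))

noncomputable instance (W : Rep k G) : Module k (H0T W) :=
  inferInstanceAs (Module k (tate0 W.ρ))

/-- Functoriality of `Ĥ⁰` along morphisms of representations. -/
noncomputable def H0Tmap {W W' : Rep k G} (ψ : W ⟶ W') : H0T W →ₗ[k] H0T W' :=
  tate0map ψ.hom (fun g v => Rep.hom_comm_apply ψ g v)

/-! ### The augmentation ideal and the syzygy modules `J n` -/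

variable (G)

/-- A `G`-action on `H` induces a representation `G →* End(H →₀ k)` in the natural way. -/
noncomputable def ofMulAction (k : Type*) [CommSemiring k] (G : Type*) [Monoid G] (H : Type*)
    [MulAction G H] : Representation k G (H →₀ k) where
  toFun g := Finsupp.lmapDomain k k (g • ·)
  map_one' := by
    ext x y
    simp
  map_mul' x y := by
    ext z w
    simp [mul_smul]

/-- The augmentation map `ℤ[G] → ℤ`. -/
noncomputable def aug : (G →₀ ℤ) →ₗ[ℤ] ℤ :=
  Finsupp.linearCombination ℤ (fun _ : G => (1 : ℤ))

lemma aug_comm (g : G) (x : G →₀ ℤ) :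
    aug G (ofMulAction ℤ G G g x) = aug G x := by
  unfold aug
  simp [ofMulAction, Finsupp.linearCombination_apply]
  rw [Finsupp.sum_mapDomain_index] <;> simp

/-- The underlying `ℤ`-module of the augmentation ideal. -/
noncomputable abbrev IGcar : Type := LinearMap.ker (aug G)

/-- The representation of `G` on the augmentation ideal. -/
noncomputable def IGρ : Representation ℤ G (IGcar G) where
  toFun g := (ofMulAction ℤ G G g).restrict (p := LinearMap.ker (aug G))
    (q := LinearMap.ker (aug G)) (by
      intro x hx
      simp only [LinearMap.mem_ker] at hx ⊢
      rw [aug_comm]; exact hx)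
  map_one' := by ext x; simp [LinearMap.restrict_apply]
  map_mul' g h := by ext x; simp [LinearMap.restrict_apply, Module.End.mul_apply]

/-- The augmentation ideal `I_G` of `ℤ[G]`, as an object of `Rep ℤ G`. -/
noncomputable def IGrep : Rep ℤ G := Rep.of (IGρ G)

/-- `Hom_ℤ(X, A)` with the conjugation `G`-action, i.e. the internal hom in `Rep ℤ G`. -/
noncomputable abbrev hRep {G : Type} [Group G] (X A : Rep.{0} ℤ G) : Rep.{0} ℤ G :=
  (Rep.ihom X).obj A

/-- The `ℤ`-linear dual of the augmentation ideal, as an object of `Rep ℤ G`. -/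
noncomputable def DIG : Rep ℤ G := hRep (IGrep G) (𝟙_ (Rep ℤ G))

instance : Module.Finite ℤ (IGcar G) := by
  have : Module.Finite ℤ (G →₀ ℤ) :=
    Module.Finite.equiv (Finsupp.linearEquivFunOnFinite ℤ ℤ G).symm
  exact Module.Finite.of_injective (LinearMap.ker (aug G)).subtype Subtype.val_injective

instance : Module.Free ℤ (IGcar G) := by infer_instance

/-- Nonnegative tensor powers `I_G^{⊗ n}` (with `I_G^{⊗ 0} = ℤ`). -/
noncomputable def Jp : ℕ → Rep ℤ G
  | 0 => 𝟙_ (Rep ℤ G)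
  | n + 1 => Jp n ⊗ IGrep G

/-- Tensor powers of the dual of the augmentation ideal. -/
noncomputable def Jn : ℕ → Rep ℤ G
  | 0 => 𝟙_ (Rep ℤ G)
  | n + 1 => Jn n ⊗ DIG G

/-- The standard syzygy modules of the trivial representation `ℤ`, indexed by `ℤ`:
`J n = I_G^{⊗ n}` for `n ≥ 0`, and `J n = (I_G^∨)^{⊗ (-n)}` for `n < 0`. -/
noncomputable def J : ℤ → Rep ℤ G
  | .ofNat n => Jp G n
  | .negSucc n => Jn G (n + 1)

lemma J_ofNat (m : ℕ) : J G (m : ℤ) = Jp G m := rfl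

lemma J_neg (m : ℕ) : J G (-(m : ℤ)) = Jn G m := by cases m <;> rfl

/-- The element of `(I_G)^∨ ⊗ I_G` corresponding to the identity map. -/
noncomputable def preElt : Module.Dual ℤ (IGcar G) ⊗[ℤ] IGcar G :=
  (dualTensorHomEquiv ℤ (IGcar G) (IGcar G)).symm LinearMap.id

/-- The canonical element of `I_G ⊗ (I_G)^∨` corresponding to the identity map. -/
noncomputable def coevElt : (IGrep G ⊗ DIG G).V :=
  (TensorProduct.comm ℤ _ _) (preElt G)

lemma conj_dualTensor (g : G) (t : Module.Dual ℤ (IGcar G) ⊗[ℤ] IGcar G) :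
    dualTensorHom ℤ _ _ (TensorProduct.map ((DIG G).ρ g) ((IGrep G).ρ g) t)
      = (IGrep G).ρ g ∘ₗ (dualTensorHom ℤ _ _ t) ∘ₗ (IGrep G).ρ g⁻¹ := by
  exact LinearMap.congr_fun (Representation.dualTensorHom_comm (IGρ G) (IGρ G) g) t

lemma coevElt_invariant (g : G) :
    ((IGrep G ⊗ DIG G).ρ g) (coevElt G) = coevElt G := by
  show TensorProduct.map ((IGrep G).ρ g) ((DIG G).ρ g)
      ((TensorProduct.comm ℤ _ _) (preElt G)) = _
  refine (TensorProduct.map_comm ((IGrep G).ρ g) ((DIG G).ρ g) (preElt G)).trans ?_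
  show (TensorProduct.comm ℤ _ _) (TensorProduct.map ((DIG G).ρ g) ((IGrep G).ρ g) (preElt G))
      = (TensorProduct.comm ℤ _ _) (preElt G)
  congr 1
  apply (dualTensorHomEquiv ℤ (IGcar G) (IGcar G)).injective
  have h2 : dualTensorHom ℤ (IGcar G) (IGcar G) (preElt G) = LinearMap.id :=
    (dualTensorHomEquiv ℤ (IGcar G) (IGcar G)).apply_symm_apply LinearMap.id
  show dualTensorHom ℤ (IGcar G) (IGcar G)
      (TensorProduct.map ((DIG G).ρ g) ((IGrep G).ρ g) (preElt G))
    = dualTensorHom ℤ (IGcar G) (IGcar G) (preElt G)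
  refine (conj_dualTensor G g (preElt G)).trans ?_
  show (IGrep G).ρ g ∘ₗ dualTensorHom ℤ (IGcar G) (IGcar G) (preElt G) ∘ₗ (IGrep G).ρ g⁻¹
      = dualTensorHom ℤ (IGcar G) (IGcar G) (preElt G)
  rw [h2]
  apply LinearMap.ext
  intro v
  exact Representation.self_inv_apply (IGrep G).ρ g v

/-- The coevaluation `ℤ ⟶ I_G ⊗ I_G^∨`. -/
noncomputable def coev : 𝟙_ (Rep ℤ G) ⟶ IGrep G ⊗ DIG G := ConcreteCategory.ofHom (C := Rep ℤ G)
 { toLinearMap := LinearMap.toSpanSingleton ℤ _ (coevElt G)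
   isIntertwining' := by
    intro g
    apply LinearMap.ext
    intro z
    show LinearMap.toSpanSingleton ℤ _ (coevElt G) ((𝟙_ (Rep ℤ G)).ρ g z)
        = ((IGrep G ⊗ DIG G).ρ g) (LinearMap.toSpanSingleton ℤ _ (coevElt G) z)
    have hz : ((𝟙_ (Rep ℤ G)).ρ g z) = z := rfl
    rw [hz]
    show z • coevElt G = ((IGrep G ⊗ DIG G).ρ g) (z • coevElt G)
    rw [map_smul, coevElt_invariant] }


variable {G}

/-- One-step comparison `J (n+1) ⟶ J n ⊗ I_G`. -/
noncomputable def sMap : ∀ n : ℤ, J G (n + 1) ⟶ J G n ⊗ IGrep G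
  | .ofNat m => 𝟙 (Jp G m ⊗ IGrep G)
  | .negSucc 0 =>
      coev G ≫ (β_ (IGrep G) (DIG G)).hom ≫ ((λ_ (DIG G)).inv ▷ IGrep G)
  | .negSucc (m+1) =>
      (ρ_ (Jn G (m+1))).inv ≫ (Jn G (m+1) ◁ (coev G ≫ (β_ (IGrep G) (DIG G)).hom))
        ≫ (α_ (Jn G (m+1)) (DIG G) (IGrep G)).inv

/-- One-step comparison `J (n-1) ⟶ J n ⊗ I_G^∨`. -/
noncomputable def tMap : ∀ n : ℤ, J G (n - 1) ⟶ J G n ⊗ DIG G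
  | .ofNat 0 => 𝟙 (𝟙_ (Rep ℤ G) ⊗ DIG G)
  | .ofNat (m+1) =>
      eqToHom (congrArg (J G) (show (Int.ofNat (m+1)) - 1 = ((m:ℕ) : ℤ) by
        rw [Int.ofNat_eq_coe]; push_cast; ring)) ≫
      (ρ_ (Jp G m)).inv ≫ (Jp G m ◁ coev G) ≫ (α_ (Jp G m) (IGrep G) (DIG G)).inv
  | .negSucc m => eqToHom (show J G (Int.negSucc m - 1) = J G (Int.negSucc m) ⊗ DIG G from rfl)

/-- Comparison maps `J (i + m) ⟶ J i ⊗ J m` for `m ≥ 0`. -/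
noncomputable def μpos (i : ℤ) : ∀ m : ℕ, J G (i + m) ⟶ J G i ⊗ J G (m : ℤ)
  | 0 => eqToHom (congrArg (J G) (by omega)) ≫ (ρ_ (J G i)).inv
  | m + 1 =>
      eqToHom (congrArg (J G) (show i + ((m:ℕ)+1:ℕ) = (i + m) + 1 by omega))
        ≫ sMap (i + m) ≫ (μpos i m ▷ IGrep G) ≫ (α_ (J G i) (J G (m:ℤ)) (IGrep G)).hom

/-- Comparison maps `J (i - m) ⟶ J i ⊗ J (-m)` for `m ≥ 0`. -/
noncomputable def μneg (i : ℤ) : ∀ m : ℕ, J G (i - m) ⟶ J G i ⊗ J G (-(m : ℤ))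
  | 0 => eqToHom (congrArg (J G) (by omega)) ≫ (ρ_ (J G i)).inv
  | m + 1 =>
      eqToHom (congrArg (J G) (show i - ((m:ℕ)+1:ℕ) = (i - m) - 1 by omega))
        ≫ tMap (i - m) ≫ (μneg i m ▷ DIG G) ≫ (α_ (J G i) (J G (-(m:ℤ))) (DIG G)).hom
        ≫ (J G i ◁ (eqToHom (show J G (-(m:ℤ)) ⊗ DIG G = J G (-((m:ℕ)+1:ℕ)) by
            rw [J_neg, J_neg]; rfl)))

variable (G)

/-- The canonical comparison map `J (i+j) ⟶ J i ⊗ J j`, implementing the standard stable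
equivalences between the syzygies `J`; it induces the cup product on Tate cohomology. -/
noncomputable def μ (i : ℤ) : ∀ j : ℤ, J G (i + j) ⟶ J G i ⊗ J G j
  | .ofNat m => μpos i m
  | .negSucc m =>
      eqToHom (congrArg (J G) (show i + Int.negSucc m = i - ((m+1 : ℕ) : ℤ) by
        rw [Int.negSucc_eq]; push_cast; ring))
        ≫ μneg i (m+1)

variable {G}

/-! ### Tate cohomology in all degrees, functoriality, cup products -/

/-- Tate cohomology `Ĥ^n(G, M)` of the finite group `G` with coefficients in `M : Rep ℤ G`,
realized as `Ĥ⁰(G, Hom_ℤ(J n, M))` for the standard `n`-th syzygy `J n` of `ℤ`. -/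
noncomputable def tate (n : ℤ) (M : Rep ℤ G) : Type := H0T (hRep (J G n) M)

noncomputable instance (n : ℤ) (M : Rep ℤ G) : AddCommGroup (tate n M) :=
  inferInstanceAs (AddCommGroup (H0T (hRep (J G n) M)))

/-- The map on Tate cohomology induced by a morphism of representations. -/
noncomputable def tmap (n : ℤ) {M N : Rep ℤ G} (φ : M ⟶ N) : tate n M → tate n N :=
  H0Tmap ((Rep.ihom (J G n)).map φ)

/-- Transport of Tate cohomology along an equality of degrees. -/
noncomputable def tcast {i j : ℤ} {M : Rep ℤ G} (h : i = j) (z : tate i M) : tate j M :=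
  h ▸ z

lemma hom_invariant {X W : Rep.{0} ℤ G} (m : X ⟶ W) :
    m.hom.toLinearMap ∈ (Representation.linHom X.ρ W.ρ).invariants := by
  intro g
  show W.ρ g ∘ₗ m.hom.toLinearMap ∘ₗ X.ρ g⁻¹ = m.hom.toLinearMap
  ext v
  simp only [LinearMap.comp_apply]
  erw [Rep.hom_comm_apply m g⁻¹ v, Representation.self_inv_apply]; rfl

/-- The Tate cohomology class of a `G`-equivariant map `J n ⟶ W`. -/
noncomputable def mkCls {n : ℤ} {W : Rep ℤ G} (m : J G n ⟶ W) : tate n W :=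
  tate0mk m.hom.toLinearMap (hom_invariant m)


lemma tensor_rho_eq (M N : Rep ℤ G) (g : G) :
    (M ⊗ N).ρ g = TensorProduct.map (M.ρ g) (N.ρ g) := rfl

lemma cup_invariance {i j : ℤ} {M N : Rep ℤ G}
    (f : ((hRep (J G i) M).ρ.invariants))
    (g : ((hRep (J G j) N).ρ.invariants)) :
    (TensorProduct.map f.1 g.1).comp ((μ G i j).hom.toLinearMap)
      ∈ (hRep (J G (i + j)) (M ⊗ N)).ρ.invariants := by
  intro gg
  have hf : M.ρ gg ∘ₗ f.1 ∘ₗ (J G i).ρ gg⁻¹ = f.1 := f.2 gg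
  have hg : N.ρ gg ∘ₗ g.1 ∘ₗ (J G j).ρ gg⁻¹ = g.1 := g.2 gg
  have hμ : (μ G i j).hom.toLinearMap.comp ((J G (i + j)).ρ gg⁻¹)
      = (TensorProduct.map ((J G i).ρ gg⁻¹) ((J G j).ρ gg⁻¹)).comp (μ G i j).hom.toLinearMap := by
    have h := (μ G i j).hom.isIntertwining' gg⁻¹
    exact h
  have key : ∀ (f' : (J G i).V →ₗ[ℤ] M.V) (g' : (J G j).V →ₗ[ℤ] N.V),
      M.ρ gg ∘ₗ f' ∘ₗ (J G i).ρ gg⁻¹ = f' → N.ρ gg ∘ₗ g' ∘ₗ (J G j).ρ gg⁻¹ = g' →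
      TensorProduct.map (M.ρ gg) (N.ρ gg) ∘ₗ
          ((TensorProduct.map f' g').comp (μ G i j).hom.toLinearMap) ∘ₗ (J G (i + j)).ρ gg⁻¹
        = (TensorProduct.map f' g').comp (μ G i j).hom.toLinearMap := by
    intro f' g' hf hg
    rw [LinearMap.comp_assoc, hμ, ← LinearMap.comp_assoc,
      ← LinearMap.comp_assoc, ← TensorProduct.map_comp, ← TensorProduct.map_comp]
    rw [LinearMap.comp_assoc (((J G i)).ρ gg⁻¹) f' (M.ρ gg),
      LinearMap.comp_assoc (((J G j)).ρ gg⁻¹) g' (N.ρ gg), hf, hg]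
  exact key f.1 g.1 hf hg

lemma conj_term {i j : ℤ} {M N : Rep ℤ G} (u : (J G i).V →ₗ[ℤ] M.V)
    (w : (J G j).V →ₗ[ℤ] N.V) (h : G) :
    (TensorProduct.map (M.ρ h ∘ₗ u ∘ₗ (J G i).ρ h⁻¹) (N.ρ h ∘ₗ w ∘ₗ (J G j).ρ h⁻¹)).comp
        (μ G i j).hom.toLinearMap
      = ((hRep (J G (i + j)) (M ⊗ N)).ρ h) ((TensorProduct.map u w).comp (μ G i j).hom.toLinearMap) := by
  have hμ : (μ G i j).hom.toLinearMap ∘ₗ (J G (i + j)).ρ h⁻¹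
      = TensorProduct.map ((J G i).ρ h⁻¹) ((J G j).ρ h⁻¹) ∘ₗ (μ G i j).hom.toLinearMap := by
    have hc := (μ G i j).hom.isIntertwining' h⁻¹
    exact hc
  show _ = (M ⊗ N).ρ h ∘ₗ ((TensorProduct.map u w).comp (μ G i j).hom.toLinearMap) ∘ₗ (J G (i + j)).ρ h⁻¹
  rw [LinearMap.comp_assoc, hμ, ← LinearMap.comp_assoc, ← LinearMap.comp_assoc]
  rw [TensorProduct.map_comp, TensorProduct.map_comp]
  rfl

lemma cup_norm_left {i j : ℤ} {M N : Rep ℤ G} (u : (J G i).V →ₗ[ℤ] M.V)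
    (g : ((hRep (J G j) N).ρ.invariants)) :
    (TensorProduct.map (rnorm ((hRep (J G i) M).ρ) u) g.1).comp (μ G i j).hom.toLinearMap
      = rnorm ((hRep (J G (i + j)) (M ⊗ N)).ρ)
          ((TensorProduct.map u g.1).comp (μ G i j).hom.toLinearMap) := by
  have h1 : rnorm ((hRep (J G i) M).ρ) u = ∑ h : G, ((hRep (J G i) M).ρ h) u := by
    exact rnorm_apply _ _
  have h2 : rnorm ((hRep (J G (i + j)) (M ⊗ N)).ρ) ((TensorProduct.map u g.1).comp (μ G i j).hom.toLinearMap)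
      = ∑ h : G, ((hRep (J G (i + j)) (M ⊗ N)).ρ h)
          ((TensorProduct.map u g.1).comp (μ G i j).hom.toLinearMap) := by
    exact rnorm_apply _ _
  rw [h1, h2]
  have h3 : TensorProduct.map (∑ h : G, ((hRep (J G i) M).ρ h) u) g.1
      = ∑ h : G, TensorProduct.map (((hRep (J G i) M).ρ h) u) g.1 :=
    map_sum ((TensorProduct.mapBilinear (.id ℤ) _ _ _ _).flip g.1) _ _
  refine (congrArg (fun t => t ∘ₗ (μ G i j).hom.toLinearMap) h3).trans ?_
  refine (show (∑ h : G, TensorProduct.map (((hRep (J G i) M).ρ h) u) g.1) ∘ₗ (μ G i j).hom.toLinearMap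
      = ∑ h : G, (TensorProduct.map (((hRep (J G i) M).ρ h) u) g.1) ∘ₗ (μ G i j).hom.toLinearMap from
    map_sum ((LinearMap.llcomp ℤ _ _ _).flip (μ G i j).hom.toLinearMap) _ _).trans ?_
  refine Finset.sum_congr rfl fun h _ => ?_
  have hginv : N.ρ h ∘ₗ g.1 ∘ₗ (J G j).ρ h⁻¹ = g.1 := g.2 h
  refine Eq.trans ?_ (conj_term u g.1 h)
  exact congrArg (fun t : (J G j).V →ₗ[ℤ] N.V =>
    (TensorProduct.map (M.ρ h ∘ₗ u ∘ₗ (J G i).ρ h⁻¹) t).comp (μ G i j).hom.toLinearMap) hginv.symm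

lemma cup_norm_right {i j : ℤ} {M N : Rep ℤ G}
    (f : ((hRep (J G i) M).ρ.invariants)) (w : (J G j).V →ₗ[ℤ] N.V) :
    (TensorProduct.map f.1 (rnorm ((hRep (J G j) N).ρ) w)).comp (μ G i j).hom.toLinearMap
      = rnorm ((hRep (J G (i + j)) (M ⊗ N)).ρ)
          ((TensorProduct.map f.1 w).comp (μ G i j).hom.toLinearMap) := by
  have h1 : rnorm ((hRep (J G j) N).ρ) w = ∑ h : G, ((hRep (J G j) N).ρ h) w := by
    exact rnorm_apply _ _
  have h2 : rnorm ((hRep (J G (i + j)) (M ⊗ N)).ρ) ((TensorProduct.map f.1 w).comp (μ G i j).hom.toLinearMap)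
      = ∑ h : G, ((hRep (J G (i + j)) (M ⊗ N)).ρ h)
          ((TensorProduct.map f.1 w).comp (μ G i j).hom.toLinearMap) := by
    exact rnorm_apply _ _
  rw [h1, h2]
  have h3 : TensorProduct.map f.1 (∑ h : G, ((hRep (J G j) N).ρ h) w)
      = ∑ h : G, TensorProduct.map f.1 (((hRep (J G j) N).ρ h) w) :=
    map_sum (TensorProduct.mapBilinear (.id ℤ) _ _ _ _ f.1) _ _
  refine (congrArg (fun t => t ∘ₗ (μ G i j).hom.toLinearMap) h3).trans ?_
  refine (show (∑ h : G, TensorProduct.map f.1 (((hRep (J G j) N).ρ h) w)) ∘ₗ (μ G i j).hom.toLinearMap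
      = ∑ h : G, (TensorProduct.map f.1 (((hRep (J G j) N).ρ h) w)) ∘ₗ (μ G i j).hom.toLinearMap from
    map_sum ((LinearMap.llcomp ℤ _ _ _).flip (μ G i j).hom.toLinearMap) _ _).trans ?_
  refine Finset.sum_congr rfl fun h _ => ?_
  have hfinv : M.ρ h ∘ₗ f.1 ∘ₗ (J G i).ρ h⁻¹ = f.1 := f.2 h
  refine Eq.trans ?_ (conj_term f.1 w h)
  exact congrArg (fun t : (J G i).V →ₗ[ℤ] M.V =>
    (TensorProduct.map t (N.ρ h ∘ₗ w ∘ₗ (J G j).ρ h⁻¹)).comp (μ G i j).hom.toLinearMap) hfinv.symm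

lemma cup_welldef {i j : ℤ} {M N : Rep ℤ G}
    (a₁ : ((hRep (J G i) M).ρ.invariants)) (b₁ : ((hRep (J G j) N).ρ.invariants))
    (a₂ : ((hRep (J G i) M).ρ.invariants)) (b₂ : ((hRep (J G j) N).ρ.invariants))
    (ha : a₁ - a₂ ∈ rnormIm ((hRep (J G i) M).ρ))
    (hb : b₁ - b₂ ∈ rnormIm ((hRep (J G j) N).ρ)) :
    tate0mk (ρ := (hRep (J G (i + j)) (M ⊗ N)).ρ) ((TensorProduct.map a₁.1 b₁.1).comp ((μ G i j).hom.toLinearMap)) (cup_invariance a₁ b₁)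
      = tate0mk (ρ := (hRep (J G (i + j)) (M ⊗ N)).ρ) ((TensorProduct.map a₂.1 b₂.1).comp ((μ G i j).hom.toLinearMap)) (cup_invariance a₂ b₂) := by
  obtain ⟨u, hu⟩ := ha
  obtain ⟨w, hw⟩ := hb
  have hu' : rnorm ((hRep (J G i) M).ρ) u = a₁.1 - a₂.1 := congrArg Subtype.val hu
  have hw' : rnorm ((hRep (J G j) N).ρ) w = b₁.1 - b₂.1 := congrArg Subtype.val hw
  have step1 : tate0mk (ρ := (hRep (J G (i + j)) (M ⊗ N)).ρ) ((TensorProduct.map a₁.1 b₁.1).comp ((μ G i j).hom.toLinearMap))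
        (cup_invariance a₁ b₁)
      = tate0mk (ρ := (hRep (J G (i + j)) (M ⊗ N)).ρ) ((TensorProduct.map a₂.1 b₁.1).comp ((μ G i j).hom.toLinearMap)) (cup_invariance a₂ b₁) := by
    refine (Submodule.Quotient.eq _).mpr ?_
    refine ⟨(TensorProduct.map u b₁.1).comp ((μ G i j).hom.toLinearMap), ?_⟩
    apply Subtype.ext
    have key := cup_norm_left u b₁
    refine key.symm.trans ?_
    refine (congrArg (fun t : (J G i).V →ₗ[ℤ] M.V =>
      (TensorProduct.map t b₁.1).comp (μ G i j).hom.toLinearMap) hu').trans ?_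
    show _ = (TensorProduct.map a₁.1 b₁.1).comp ((μ G i j).hom.toLinearMap)
        - (TensorProduct.map a₂.1 b₁.1).comp ((μ G i j).hom.toLinearMap)
    refine (congrArg (fun t => t ∘ₗ (μ G i j).hom.toLinearMap)
      (show TensorProduct.map (a₁.1 - a₂.1) b₁.1
        = TensorProduct.map a₁.1 b₁.1 - TensorProduct.map a₂.1 b₁.1 from
      map_sub ((TensorProduct.mapBilinear (.id ℤ) _ _ _ _).flip b₁.1) _ _)).trans ?_
    exact LinearMap.sub_comp _ _ _
  have step2 : tate0mk (ρ := (hRep (J G (i + j)) (M ⊗ N)).ρ) ((TensorProduct.map a₂.1 b₁.1).comp ((μ G i j).hom.toLinearMap))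
        (cup_invariance a₂ b₁)
      = tate0mk (ρ := (hRep (J G (i + j)) (M ⊗ N)).ρ) ((TensorProduct.map a₂.1 b₂.1).comp ((μ G i j).hom.toLinearMap)) (cup_invariance a₂ b₂) := by
    refine (Submodule.Quotient.eq _).mpr ?_
    refine ⟨(TensorProduct.map a₂.1 w).comp ((μ G i j).hom.toLinearMap), ?_⟩
    apply Subtype.ext
    have key := cup_norm_right a₂ w
    refine key.symm.trans ?_
    refine (congrArg (fun t : (J G j).V →ₗ[ℤ] N.V =>
      (TensorProduct.map a₂.1 t).comp (μ G i j).hom.toLinearMap) hw').trans ?_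
    show _ = (TensorProduct.map a₂.1 b₁.1).comp ((μ G i j).hom.toLinearMap)
        - (TensorProduct.map a₂.1 b₂.1).comp ((μ G i j).hom.toLinearMap)
    refine (congrArg (fun t => t ∘ₗ (μ G i j).hom.toLinearMap)
      (show TensorProduct.map a₂.1 (b₁.1 - b₂.1)
        = TensorProduct.map a₂.1 b₁.1 - TensorProduct.map a₂.1 b₂.1 from
      map_sub ((TensorProduct.mapBilinear (.id ℤ) _ _ _ _) a₂.1) _ _)).trans ?_
    exact LinearMap.sub_comp _ _ _
  exact step1.trans step2

/-- The cup product `Ĥ^i(G, M) × Ĥ^j(G, N) → Ĥ^{i+j}(G, M ⊗ N)` on Tate cohomology,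
induced by the comparison maps `μ`. -/
noncomputable def cup {i j : ℤ} {M N : Rep ℤ G} (z₁ : tate i M) (z₂ : tate j N) :
    tate (i + j) (M ⊗ N) :=
  Quotient.liftOn₂ z₁ z₂
    (fun f g => tate0mk ((TensorProduct.map f.1 g.1).comp ((μ G i j).hom.toLinearMap)) (cup_invariance f g))
    (fun a₁ b₁ a₂ b₂ ha hb => cup_welldef a₁ b₁ a₂ b₂
      ((Submodule.quotientRel_def _).mp ha) ((Submodule.quotientRel_def _).mp hb))

/-! ### Pairings -/

/-- The composition pairing `Hom_ℤ(B, C) ⊗ Hom_ℤ(A, B) ⟶ Hom_ℤ(A, C)`, `f ⊗ φ ↦ f ∘ φ`. -/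
noncomputable def compPair (A B C : Rep ℤ G) : hRep B C ⊗ hRep A B ⟶ hRep A C :=
  MonoidalClosed.curry <|
    (A ◁ (β_ (hRep B C) (hRep A B)).hom) ≫ (α_ A (hRep A B) (hRep B C)).inv
      ≫ (((ihom.ev A).app B) ▷ hRep B C) ≫ (ihom.ev B).app C

/-- The evaluation pairing `Hom_ℤ(X, B) ⊗ X ⟶ B`, `f ⊗ x ↦ f x`. -/
noncomputable def evPair (X B : Rep ℤ G) : hRep X B ⊗ X ⟶ B :=
  (β_ (hRep X B) X).hom ≫ (ihom.ev X).app B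

/-- The cup product `Ĥ^i(G, Hom(X, A)) × Ĥ^j(G, Hom(X', X)) → Ĥ^{i+j}(G, Hom(X', A))`
induced by the composition pairing. -/
noncomputable def ccup {i j : ℤ} {X X' A : Rep ℤ G}
    (z : tate i (hRep X A)) (x : tate j (hRep X' X)) : tate (i + j) (hRep X' A) :=
  tmap (i + j) (compPair X' X A) (cup z x)

/-- `ccup`, with the degree of the target adjusted along an equality of integers. -/
noncomputable def ccupTo {i j m : ℤ} {X X' A : Rep ℤ G}
    (z : tate i (hRep X A)) (x : tate j (hRep X' X)) (h : i + j = m) :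
    tate m (hRep X' A) :=
  tcast h (ccup z x)

/-- The class of the identity in `Ĥ⁰(G, Hom_ℤ(X, X))`. -/
noncomputable def idCls (X : Rep ℤ G) : tate 0 (hRep X X) :=
  mkCls (MonoidalClosed.curry (ρ_ X).hom)

/-! ### Encoding pairs and related notions -/

/-- `(X, X')` is an *`r`-encoding pair* if for some `i ∈ ℤ` there is a natural isomorphism
of functors `Ĥ^i(G, Hom_ℤ(X, -)) ≅ Ĥ^{i+r}(G, Hom_ℤ(X', -))` on `Rep ℤ G`. -/
def IsEncodingPair {G : Type} [Group G] [Fintype G] (r : ℤ) (X X' : Rep ℤ G) : Prop :=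
  ∃ (i : ℤ) (e : ∀ A : Rep ℤ G, tate i (hRep X A) ≃+ tate (i + r) (hRep X' A)),
    ∀ {A B : Rep ℤ G} (φ : A ⟶ B) (z : tate i (hRep X A)),
      e B (tmap i ((Rep.ihom X).map φ) z) = tmap (i + r) ((Rep.ihom X').map φ) (e A z)

/-- `x ∈ Ĥ^r(G, Hom_ℤ(X', X))` is an *encoding element* for the pair `(X, X')` if it has a
*decoding element* `x' ∈ Ĥ^{-r}(G, Hom_ℤ(X, X'))` with `x' ∪ x = [id_{X'}]` and
`x ∪ x' = [id_X]`. -/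
def IsEncodingElement {G : Type} [Group G] [Fintype G] {r : ℤ} (X X' : Rep ℤ G)
    (x : tate r (hRep X' X)) : Prop :=
  ∃ x' : tate (-r) (hRep X X'),
    ccupTo x' x (by ring) = idCls X' ∧ ccupTo x x' (by ring) = idCls X

/-- The induced `G`-module `ℤ[G] ⊗_ℤ A ≅ (G →₀ A)`, with `G` acting by left translation. -/
noncomputable def indRep (G : Type) [Group G] (A : Type) [AddCommGroup A] [Module ℤ A] :
    Rep ℤ G :=
  Rep.of (G := G) (X := G →₀ A)
    { toFun := fun g => Finsupp.lmapDomain A ℤ (fun h => g * h)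
      map_one' := by
        ext x h
        simp [Finsupp.lmapDomain_apply, Finsupp.mapDomain_id, one_mul]
      map_mul' := fun g g' => by
        ext x h
        simp [Finsupp.lmapDomain_apply, Module.End.mul_apply, Finsupp.mapDomain_single,
          mul_assoc] }

/-- A `G`-module is *induced* if it is isomorphic to `ℤ[G] ⊗_ℤ A` for some abelian group `A`. -/
def IsInduced {G : Type} [Group G] (M : Rep ℤ G) : Prop :=
  ∃ (A : Type) (_ : AddCommGroup A) (_ : Module ℤ A), Nonempty (M ≅ indRep G A)

/-- A class `φ ∈ Ĥ⁰(G, Hom_ℤ(X, X))` is a unit for the (composition) cup product. -/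
def IsUnitCls {G : Type} [Group G] [Fintype G] {X : Rep ℤ G}
    (φ : tate 0 (hRep X X)) : Prop :=
  ∃ ψ : tate 0 (hRep X X),
    ccupTo φ ψ (by ring) = idCls X ∧ ccupTo ψ φ (by ring) = idCls X


/-- The natural map `Hom_ℤ(X, A) ⊗ I_G ⟶ Hom_ℤ(X, A ⊗ I_G)`, `f ⊗ z ↦ (x ↦ f x ⊗ z)`. -/
noncomputable def pr0 (X A : Rep ℤ G) : hRep X A ⊗ IGrep G ⟶ hRep X (A ⊗ IGrep G) :=
  MonoidalClosed.curry ((α_ X (hRep X A) (IGrep G)).inv ≫ ((ihom.ev X).app A ▷ IGrep G))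

/-- The natural evaluation map `Hom_ℤ(X, Hom_ℤ(I_G, A)) ⊗ I_G ⟶ Hom_ℤ(X, A)`,
`f ⊗ z ↦ (x ↦ f x z)`. -/
noncomputable def pr1 (X A : Rep ℤ G) :
    hRep X (hRep (IGrep G) A) ⊗ IGrep G ⟶ hRep X A :=
  MonoidalClosed.curry ((α_ X (hRep X (hRep (IGrep G) A)) (IGrep G)).inv
    ≫ ((ihom.ev X).app (hRep (IGrep G) A) ▷ IGrep G) ≫ evPair (IGrep G) A)

/-- The natural evaluation map `Hom_ℤ(X', X) ⊗ (X' ⊗ A) ⟶ X ⊗ A`. -/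
noncomputable def tPair (X' X A : Rep ℤ G) : hRep X' X ⊗ (X' ⊗ A) ⟶ X ⊗ A :=
  (α_ (hRep X' X) X' A).inv ≫ (evPair X' X ▷ A)

/-- A functor `Rep ℤ G ⥤ Rep ℤ G` sends `ℤ`-split short exact sequences of `G`-modules to
short exact sequences of `G`-modules. -/
def PreservesZSplitSES {G : Type} [Group G] (F : Rep.{0} ℤ G ⥤ Rep.{0} ℤ G) : Prop :=
  ∀ (A B C : Rep ℤ G) (f : A ⟶ B) (g : B ⟶ C),
    Function.Injective f.hom → Function.Surjective g.hom → Function.Exact f.hom g.hom →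
    (∃ s : C.V →+ B.V, ∀ x, g.hom (s x) = x) →
    Function.Injective (F.map f).hom ∧ Function.Surjective (F.map g).hom ∧
      Function.Exact (F.map f).hom (F.map g).hom

/-- A *shiftable functor*: it sends `ℤ`-split short exact sequences of `G`-modules to short
exact sequences, and sends induced modules to induced modules. -/
def Shiftable {G : Type} [Group G] (F : Rep.{0} ℤ G ⥤ Rep.{0} ℤ G) : Prop :=
  PreservesZSplitSES F ∧ ∀ M : Rep ℤ G, IsInduced M → IsInduced (F.obj M)

end Enc

open CategoryTheory MonoidalCategory Enc

namespace EncAux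

open TensorProduct

variable {G : Type} [Group G]

/-- `D^∨ ⊗ W → Hom(U, W)`. -/
noncomputable def dT (U W : Rep.{0} ℤ G) : hRep U (𝟙_ (Rep ℤ G)) ⊗ W ⟶ hRep U W :=
  Rep.ofHom (σ := Representation.linHom U.ρ W.ρ) ⟨dualTensorHom ℤ U.V W.V, fun g => by
    apply TensorProduct.ext'
    intro f w
    apply LinearMap.ext
    intro x
    let f' : U.V →ₗ[ℤ] ℤ := f
    exact (LinearMap.map_smul (W.ρ g) (f' (U.ρ g⁻¹ x)) w).symm⟩

/-- `U ⊗ W → Hom(U^∨, W)`. -/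
noncomputable def eT (U W : Rep.{0} ℤ G) : U ⊗ W ⟶ hRep (hRep U (𝟙_ (Rep ℤ G))) W :=
  Rep.ofHom (σ := Representation.linHom (hRep U (𝟙_ (Rep ℤ G))).ρ W.ρ)
   ⟨dualTensorHom ℤ (Module.Dual ℤ U.V) W.V ∘ₗ
      TensorProduct.map (Module.Dual.eval ℤ U.V) LinearMap.id, fun g => by
    apply TensorProduct.ext'
    intro y w
    apply LinearMap.ext
    intro f
    let f' : U.V →ₗ[ℤ] ℤ := f
    refine Eq.trans ?_ (LinearMap.map_smul (W.ρ g) (f' (U.ρ g⁻¹⁻¹ y)) w).symm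
    rw [inv_inv]
    rfl⟩

lemma isIso_of_bij {A B : Rep.{0} ℤ G} (f : A ⟶ B) (h : Function.Bijective f.hom) : IsIso f := by
  have : IsIso ((forget (Rep ℤ G)).map f) := (isIso_iff_bijective _).2 h
  exact isIso_of_reflects_iso f (forget (Rep ℤ G))

noncomputable def dTIso (U : Rep.{0} ℤ G) [Module.Finite ℤ U.V] [Module.Free ℤ U.V] :
    tensorLeft (hRep U (𝟙_ (Rep ℤ G))) ≅ Rep.ihom U :=
  haveI : ∀ W, IsIso (dT U W) :=
    fun W => isIso_of_bij _ (dualTensorHomEquiv ℤ U.V W.V).bijective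
  NatIso.ofComponents (fun W => asIso (dT U W)) (by
    intro W W' f
    apply Rep.hom_ext
    apply Representation.IntertwiningMap.ext
    apply TensorProduct.ext'
    intro φ w
    apply LinearMap.ext
    intro x
    let φ' : U.V →ₗ[ℤ] ℤ := φ
    exact (LinearMap.map_smul f.hom.toLinearMap (φ' x) w).symm)

noncomputable def eTIso (U : Rep.{0} ℤ G) [Module.Finite ℤ U.V] [Module.Free ℤ U.V] :
    tensorLeft U ≅ Rep.ihom (hRep U (𝟙_ (Rep ℤ G))) :=
  haveI : ∀ W, IsIso (eT U W) :=
    fun W => isIso_of_bij _ (by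
      have h1 := (dualTensorHomEquiv ℤ (Module.Dual ℤ U.V) W.V).bijective
      have h2 := (TensorProduct.congr (Module.evalEquiv ℤ U.V) (LinearEquiv.refl ℤ W.V)).bijective
      exact h1.comp h2)
  NatIso.ofComponents (fun W => asIso (eT U W)) (by
    intro W W' f
    apply Rep.hom_ext
    apply Representation.IntertwiningMap.ext
    apply TensorProduct.ext'
    intro y w
    apply LinearMap.ext
    intro φ
    let φ' : U.V →ₗ[ℤ] ℤ := φ
    exact (LinearMap.map_smul f.hom.toLinearMap (φ' y) w).symm)

noncomputable def ihomAdj (U : Rep.{0} ℤ G) : tensorLeft U ⊣ Rep.ihom U := ihom.adjunction U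

def DualTo (U V : Rep.{0} ℤ G) : Prop := Nonempty (tensorLeft U ⊣ tensorLeft V)

lemma dualTo_unit : DualTo (𝟙_ (Rep.{0} ℤ G)) (𝟙_ (Rep ℤ G)) :=
  ⟨(Adjunction.id.ofNatIsoLeft (leftUnitorNatIso (Rep ℤ G)).symm).ofNatIsoRight
    (leftUnitorNatIso (Rep ℤ G)).symm⟩

lemma DualTo.tensor {U V U' V' : Rep.{0} ℤ G} (h : DualTo U V) (h' : DualTo U' V') :
    DualTo (U ⊗ U') (V ⊗ V') := by
  obtain ⟨a⟩ := h
  obtain ⟨b⟩ := h'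
  refine ⟨((b.comp a).ofNatIsoLeft (tensorLeftTensor U U').symm).ofNatIsoRight ?_⟩
  exact (tensorLeftTensor V' V).symm ≪≫ (curriedTensor (Rep ℤ G)).mapIso (β_ V' V)

lemma dual_hRep {U V : Rep.{0} ℤ G} (h : DualTo U V) (Y M : Rep.{0} ℤ G) :
    Nonempty (hRep (Y ⊗ U) M ≅ hRep Y M ⊗ V) := by
  obtain ⟨a⟩ := h
  have b := (a.comp (ihomAdj Y)).ofNatIsoLeft (tensorLeftTensor Y U).symm
  exact ⟨((ihomAdj (Y ⊗ U)).rightAdjointUniq b).app M ≪≫ β_ _ _⟩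

lemma ihom_ihom (X U : Rep.{0} ℤ G) : Nonempty ((Rep.ihom X : Rep.{0} ℤ G ⥤ Rep.{0} ℤ G) ⋙ Rep.ihom U ≅ Rep.ihom (X ⊗ U)) :=
  ⟨(((ihomAdj U).comp (ihomAdj X)).ofNatIsoLeft (tensorLeftTensor X U).symm).rightAdjointUniq
    (ihomAdj (X ⊗ U))⟩

variable [Fintype G]

instance : Module.Finite ℤ (IGrep G).V := inferInstanceAs (Module.Finite ℤ (IGcar G))
instance : Module.Free ℤ (IGrep G).V := inferInstanceAs (Module.Free ℤ (IGcar G))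

lemma dual_I : DualTo (IGrep G) (DIG G) :=
  ⟨(ihomAdj _).ofNatIsoRight (dTIso (IGrep G)).symm⟩

lemma dual_D : DualTo (DIG G) (IGrep G) :=
  ⟨(ihomAdj _).ofNatIsoRight (eTIso (IGrep G)).symm⟩

lemma dual_p : ∀ n : ℕ, DualTo (Jp G n) (Jn G n)
  | 0 => dualTo_unit
  | n + 1 => (dual_p n).tensor dual_I

lemma dual_n : ∀ n : ℕ, DualTo (Jn G n) (Jp G n)
  | 0 => dualTo_unit
  | n + 1 => (dual_n n).tensor dual_D

lemma dual_J : ∀ n : ℤ, DualTo (J G n) (J G (-n))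
  | .ofNat n => by
      have := dual_p (G := G) n
      rw [← J_neg] at this
      exact this
  | .negSucc n => dual_n (n + 1)

end EncAux

namespace EncAux

variable {G : Type} [Group G] [Fintype G]

/-- `Ĥ⁰` as a functor. -/
noncomputable def H0F : Rep.{0} ℤ G ⥤ AddCommGrpCat.{0} where
  obj W := AddCommGrpCat.of (H0T W)
  map f := AddCommGrpCat.ofHom (H0Tmap f).toAddMonoidHom
  map_id W := by
    ext z
    obtain ⟨z, rfl⟩ := Submodule.Quotient.mk_surjective _ z
    rfl
  map_comp f g := by
    ext z
    obtain ⟨z, rfl⟩ := Submodule.Quotient.mk_surjective _ z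
    rfl

/-- The functor `A ↦ Ĥ⁰(G, Hom(P, A))`. -/
noncomputable def S (P : Rep.{0} ℤ G) : Rep.{0} ℤ G ⥤ AddCommGrpCat.{0} := Rep.ihom P ⋙ H0F

/-- The class of a morphism in `Ĥ⁰(G, Hom(P, Q))`. -/
noncomputable def cls {P Q : Rep.{0} ℤ G} (f : P ⟶ Q) : H0T (hRep P Q) :=
  tate0mk (ρ := (hRep P Q).ρ) f.hom.toLinearMap (hom_invariant f)

lemma cls_surj {P Q : Rep.{0} ℤ G} (z : H0T (hRep P Q)) : ∃ f : P ⟶ Q, cls f = z := by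
  obtain ⟨⟨z, hz⟩, rfl⟩ := Submodule.Quotient.mk_surjective _ z
  let z' : P.V →ₗ[ℤ] Q.V := z
  refine ⟨Rep.ofHom ⟨z', fun g => ?_⟩, rfl⟩
  have h : Q.ρ g ∘ₗ z' ∘ₗ P.ρ g⁻¹ = z' := hz g
  apply LinearMap.ext
  intro x
  have := LinearMap.congr_fun h (P.ρ g x)
  refine this.symm.trans ?_
  show Q.ρ g (z' (P.ρ g⁻¹ (P.ρ g x))) = Q.ρ g (z' x)
  rw [Representation.inv_self_apply]

/-- Two morphisms are stably equal if they differ by a norm. -/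
def StEq {P Q : Rep.{0} ℤ G} (f g : P ⟶ Q) : Prop :=
  ∃ u : P.V →ₗ[ℤ] Q.V, ∀ x, f.hom x - g.hom x = ∑ h : G, Q.ρ h (u (P.ρ h⁻¹ x))

lemma rnorm_hRep {P Q : Rep.{0} ℤ G} (u : P.V →ₗ[ℤ] Q.V) (x : P.V) :
    (show P.V →ₗ[ℤ] Q.V from rnorm (hRep P Q).ρ u) x = ∑ h : G, Q.ρ h (u (P.ρ h⁻¹ x)) := by
  have h1 : (show P.V →ₗ[ℤ] Q.V from rnorm (hRep P Q).ρ u) =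
      ∑ h : G, Q.ρ h ∘ₗ u ∘ₗ P.ρ h⁻¹ :=
    rnorm_apply (hRep P Q).ρ u
  rw [h1, LinearMap.sum_apply]
  rfl

lemma cls_eq_iff {P Q : Rep.{0} ℤ G} (f g : P ⟶ Q) : cls f = cls g ↔ StEq f g := by
  refine (Submodule.Quotient.eq _).trans ?_
  constructor
  · rintro ⟨u, hu⟩
    refine ⟨u, fun x => ?_⟩
    have hu' : rnorm (hRep P Q).ρ u = f.hom.toLinearMap - g.hom.toLinearMap :=
      congrArg Subtype.val hu
    exact (LinearMap.congr_fun hu'.symm x).trans (rnorm_hRep u x)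
  · rintro ⟨u, hu⟩
    refine ⟨u, Subtype.ext ?_⟩
    apply LinearMap.ext
    intro x
    exact (rnorm_hRep u x).trans (hu x).symm

/-- Precomposition. -/
noncomputable def preH {P Q : Rep.{0} ℤ G} (f : P ⟶ Q) (A : Rep.{0} ℤ G) :
    hRep Q A ⟶ hRep P A :=
  Rep.ofHom (ρ := Representation.linHom Q.ρ A.ρ) (σ := Representation.linHom P.ρ A.ρ)
    ⟨LinearMap.lcomp ℤ A.V f.hom.toLinearMap, fun g => by
      apply LinearMap.ext
      intro φ
      apply LinearMap.ext
      intro x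
      show A.ρ g (φ (Q.ρ g⁻¹ (f.hom x))) = A.ρ g (φ (f.hom (P.ρ g⁻¹ x)))
      rw [Rep.hom_comm_apply]⟩

lemma preH_comp {P Q R : Rep.{0} ℤ G} (f : P ⟶ Q) (g : Q ⟶ R) (A : Rep.{0} ℤ G) :
    preH (f ≫ g) A = preH g A ≫ preH f A := rfl

lemma preH_id (P A : Rep.{0} ℤ G) : preH (𝟙 P) A = 𝟙 _ := rfl

/-- Stable isomorphism. -/
def StIso (P Q : Rep.{0} ℤ G) : Prop :=
  ∃ (f : P ⟶ Q) (g : Q ⟶ P), StEq (f ≫ g) (𝟙 P) ∧ StEq (g ≫ f) (𝟙 Q)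

lemma StEq.pre {P Q : Rep.{0} ℤ G} {f g : P ⟶ Q} (h : StEq f g) (M : Rep.{0} ℤ G) :
    StEq (preH f M) (preH g M) := by
  obtain ⟨u, hu⟩ := h
  refine ⟨LinearMap.lcomp ℤ M.V u, fun φ => ?_⟩
  let φ' : Q.V →ₗ[ℤ] M.V := φ
  have key : φ' ∘ₗ f.hom.toLinearMap - φ' ∘ₗ g.hom.toLinearMap =
      ∑ h : G, M.ρ h ∘ₗ ((M.ρ h⁻¹ ∘ₗ φ' ∘ₗ Q.ρ h⁻¹⁻¹) ∘ₗ u) ∘ₗ P.ρ h⁻¹ := by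
    apply LinearMap.ext
    intro x
    rw [LinearMap.sum_apply]
    refine (map_sub φ' (f.hom x) (g.hom x)).symm.trans ?_
    rw [hu x, map_sum]
    refine Finset.sum_congr rfl fun h _ => ?_
    show _ = M.ρ h (M.ρ h⁻¹ (φ' (Q.ρ h⁻¹⁻¹ (u (P.ρ h⁻¹ x)))))
    rw [Representation.self_inv_apply, inv_inv]
  exact key

lemma StIso.dual {P Q : Rep.{0} ℤ G} (h : StIso P Q) (M : Rep.{0} ℤ G) :
    StIso (hRep Q M) (hRep P M) := by
  obtain ⟨f, g, h1, h2⟩ := h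
  exact ⟨preH f M, preH g M, h2.pre M, h1.pre M⟩

lemma S_map_cls {P A B : Rep.{0} ℤ G} (φ : A ⟶ B) (f : P ⟶ A) :
    (S P).map φ (cls f) = cls (f ≫ φ) := rfl

lemma stIso_of_iso {P Q : Rep.{0} ℤ G} (θ : S P ≅ S Q) : StIso P Q := by
  obtain ⟨g, hg⟩ := cls_surj (θ.hom.app P (cls (𝟙 P)))
  obtain ⟨f, hf⟩ := cls_surj (θ.inv.app Q (cls (𝟙 Q)))
  refine ⟨f, g, (cls_eq_iff _ _).1 ?_, (cls_eq_iff _ _).1 ?_⟩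
  · have h1 : θ.inv.app P ((S Q).map g (cls (𝟙 Q))) = (S P).map g (θ.inv.app Q (cls (𝟙 Q))) :=
      ConcreteCategory.congr_hom (θ.inv.naturality g) (cls (𝟙 Q))
    rw [← hf, S_map_cls, S_map_cls, Category.id_comp, hg] at h1
    rw [← h1]
    exact ConcreteCategory.congr_hom (θ.hom_inv_id_app P) (cls (𝟙 P))
  · have h1 : θ.hom.app Q ((S P).map f (cls (𝟙 P))) = (S Q).map f (θ.hom.app P (cls (𝟙 P))) :=
      ConcreteCategory.congr_hom (θ.hom.naturality f) (cls (𝟙 P))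
    rw [← hg, S_map_cls, S_map_cls, Category.id_comp, hf] at h1
    rw [← h1]
    exact ConcreteCategory.congr_hom (θ.inv_hom_id_app Q) (cls (𝟙 Q))

/-- Precomposition as a natural transformation. -/
noncomputable def preN {P Q : Rep.{0} ℤ G} (f : P ⟶ Q) : S Q ⟶ S P where
  app A := H0F.map (preH f A)
  naturality A B φ := by
    ext z
    obtain ⟨z, rfl⟩ := cls_surj z
    rfl

lemma preN_cls {P Q A : Rep.{0} ℤ G} (f : P ⟶ Q) (a : Q ⟶ A) :
    (preN f).app A (cls a) = cls (f ≫ a) := rfl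

lemma StEq.comp {P Q A : Rep.{0} ℤ G} {f g : P ⟶ Q} (h : StEq f g) (a : Q ⟶ A) :
    StEq (f ≫ a) (g ≫ a) := by
  obtain ⟨u, hu⟩ := h
  refine ⟨a.hom.toLinearMap ∘ₗ u, fun x => ?_⟩
  show a.hom.toLinearMap (f.hom x) - a.hom.toLinearMap (g.hom x) =
    ∑ h : G, A.ρ h (a.hom (u (P.ρ h⁻¹ x)))
  rw [← map_sub, hu x, map_sum]
  exact Finset.sum_congr rfl fun h _ => Rep.hom_comm_apply a _ _

lemma iso_of_stIso {P Q : Rep.{0} ℤ G} (h : StIso P Q) : Nonempty (S P ≅ S Q) := by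
  obtain ⟨f, g, h1, h2⟩ := h
  refine ⟨⟨preN g, preN f, ?_, ?_⟩⟩
  · ext A z
    obtain ⟨a, rfl⟩ := cls_surj z
    exact (cls_eq_iff _ _).2 (h1.comp a)
  · ext A z
    obtain ⟨a, rfl⟩ := cls_surj z
    exact (cls_eq_iff _ _).2 (h2.comp a)

lemma enc_of {r : ℤ} {X Y : Rep.{0} ℤ G} (i j : ℤ) (hj : j = i + r)
    (θ : S (X ⊗ J G i) ≅ S (Y ⊗ J G j)) : IsEncodingPair r X Y := by
  subst hj
  obtain ⟨a⟩ := ihom_ihom X (J G i)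
  obtain ⟨b⟩ := ihom_ihom Y (J G (i + r))
  let η : (Rep.ihom X ⋙ Rep.ihom (J G i)) ⋙ H0F ≅ (Rep.ihom Y ⋙ Rep.ihom (J G (i + r))) ⋙ H0F :=
    Functor.isoWhiskerRight a H0F ≪≫ θ ≪≫ (Functor.isoWhiskerRight b H0F).symm
  refine ⟨i, fun A => (η.app A).addCommGroupIsoToAddEquiv, ?_⟩
  intro A B φ z
  exact ConcreteCategory.congr_hom (η.hom.naturality φ) z

lemma of_enc {r : ℤ} {X Y : Rep.{0} ℤ G} (h : IsEncodingPair r X Y) :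
    ∃ i, Nonempty (S (X ⊗ J G i) ≅ S (Y ⊗ J G (i + r))) := by
  obtain ⟨i, e, he⟩ := h
  obtain ⟨a⟩ := ihom_ihom X (J G i)
  obtain ⟨b⟩ := ihom_ihom Y (J G (i + r))
  let η : (Rep.ihom X ⋙ Rep.ihom (J G i)) ⋙ H0F ≅ (Rep.ihom Y ⋙ Rep.ihom (J G (i + r))) ⋙ H0F :=
    NatIso.ofComponents (fun A => (e A).toAddCommGrpIso) (by
      intro A B φ
      ext z
      exact he φ z)
  exact ⟨i, ⟨(Functor.isoWhiskerRight a H0F).symm ≪≫ η ≪≫ Functor.isoWhiskerRight b H0F⟩⟩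

lemma StIso.of_iso {P Q P' Q' : Rep.{0} ℤ G} (h : StIso P Q) (a : P ≅ P') (b : Q ≅ Q') :
    StIso P' Q' := by
  obtain ⟨θ⟩ := iso_of_stIso h
  have hS : ∀ {U V : Rep.{0} ℤ G}, (U ≅ V) → Nonempty (S U ≅ S V) := fun {U V} c =>
    ⟨⟨preN c.inv, preN c.hom, by
        ext A z
        obtain ⟨x, rfl⟩ := cls_surj z
        refine (show _ = cls (c.hom ≫ c.inv ≫ x) from rfl).trans ?_
        rw [Iso.hom_inv_id_assoc]; rfl, by
        ext A z
        obtain ⟨x, rfl⟩ := cls_surj z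
        refine (show _ = cls (c.inv ≫ c.hom ≫ x) from rfl).trans ?_
        rw [Iso.inv_hom_id_assoc]; rfl⟩⟩
  obtain ⟨α⟩ := hS a
  obtain ⟨β'⟩ := hS b
  exact stIso_of_iso (α.symm ≪≫ θ ≪≫ β')

end EncAux

theorem statement9 (G : Type) [Group G] [Fintype G] (M : Rep ℤ G) (r : ℤ) (X Y : Rep ℤ G)
    (h : IsEncodingPair r X Y) : IsEncodingPair r (hRep Y M) (hRep X M) := by
  obtain ⟨i, ⟨θ⟩⟩ := EncAux.of_enc h
  obtain ⟨a⟩ := EncAux.dual_hRep (EncAux.dual_J (G := G) i) X M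
  obtain ⟨b⟩ := EncAux.dual_hRep (EncAux.dual_J (G := G) (i + r)) Y M
  obtain ⟨η⟩ := EncAux.iso_of_stIso (((EncAux.stIso_of_iso θ).dual M).of_iso b a)
  exact EncAux.enc_of (-(i + r)) (-i) (by ring) η
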